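/- arXiv:2207.06002 — 11 statements merged into one kernel-verified Lean document; each statement's English description precedes it below -/
import Mathlib

section
/- The trilinear map φ : g* × g* × g* → K defined by φ(α, β, γ) = β([h(α), h(γ)]) is alternating: it vanishes whenever two of its three arguments coincide, and hence changes sign under the transposition of any two arguments. (Equivalently, the 3-tensor φ_H = (1/2)(Id ⊗ [·,·] ⊗ Id)(H ⊗ H) ∈ g ⊗ g ⊗ g associated with the invariant symmetric 2-tensor H with adjoint h is totally antisymmetric; i.e., every invariant symmetric 2-tensor on g is quasi Poisson convenient.) -/
/-- for an invariant symmetric 2-tensor on a Lie algebra `g`, encoded by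
its symmetric equivariant adjoint `h : g* → g`, the trilinear map
`φ(α, β, γ) = β ⁅h α, h γ⁆` is alternating: it vanishes whenever two of its three
arguments coincide, and changes sign under any transposition of two arguments. -/
theorem statement0 (K : Type*) [Field K] [CharZero K]
    (g : Type*) [LieRing g] [LieAlgebra K g] [FiniteDimensional K g]
    (h : Module.Dual K g →ₗ[K] g)
    (hsym : ∀ α β : Module.Dual K g, α (h β) = β (h α))
    (hequiv : ∀ (x : g) (α : Module.Dual K g),
      h (α ∘ₗ LieAlgebra.ad K g x) = -⁅x, h α⁆) :
    ((∀ α γ : Module.Dual K g, α ⁅h α, h γ⁆ = 0) ∧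
     (∀ α β : Module.Dual K g, β ⁅h α, h α⁆ = 0) ∧
     (∀ α β : Module.Dual K g, β ⁅h α, h β⁆ = 0)) ∧
    ((∀ α β γ : Module.Dual K g, β ⁅h α, h γ⁆ = - α ⁅h β, h γ⁆) ∧
     (∀ α β γ : Module.Dual K g, β ⁅h α, h γ⁆ = - γ ⁅h α, h β⁆) ∧
     (∀ α β γ : Module.Dual K g, β ⁅h α, h γ⁆ = - β ⁅h γ, h α⁆)) := by
  have swap_right : ∀ α β γ : Module.Dual K g, β ⁅h α, h γ⁆ = - γ ⁅h α, h β⁆ := by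
    intro α β γ
    have key := hsym (β ∘ₗ LieAlgebra.ad K g (h α)) γ
    rw [hequiv, map_neg] at key
    simpa using key
  have swap_outer : ∀ α β γ : Module.Dual K g, β ⁅h α, h γ⁆ = - β ⁅h γ, h α⁆ := by
    intro α β γ
    rw [← lie_skew, map_neg]
  have swap_left : ∀ α β γ : Module.Dual K g, β ⁅h α, h γ⁆ = - α ⁅h β, h γ⁆ := by
    intro α β γ
    rw [swap_outer α β γ, swap_right γ β α, swap_outer γ α β, neg_neg]
  exact ⟨⟨fun α γ => self_eq_neg.mp (swap_left α α γ), fun α β => by simp,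
    fun α β => self_eq_neg.mp (swap_right α β β)⟩, swap_left, swap_right, swap_outer⟩
end

section
/- Let I := {h(α) : α ∈ g*} be the range of h. Then: (a) I is a Lie ideal of g; in fact [x, h(α)] = h(−α ∘ ad x) ∈ I for all x ∈ g and α ∈ g*; (b) there is a unique bilinear form B₀ on I such that B₀(h(α), y) = α(y) for all α ∈ g* and y ∈ I, and B₀ is symmetric; (c) B₀ is non-degenerate on I; (d) B₀ is invariant under the adjoint action of g: B₀([x, y], z) + B₀(y, [x, z]) = 0 for all x ∈ g and y, z ∈ I. (Thus every invariant symmetric 2-tensor on g arises from a non-degenerate invariant symmetric bilinear form on a Lie ideal of g.) -/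
/-- the range `I` of the adjoint `h : g* → g` of an invariant symmetric
2-tensor is a Lie ideal, and it carries a unique bilinear form `B₀` with
`B₀(h α, y) = α y`; this form is symmetric, non-degenerate, and invariant under the
adjoint action of `g`. -/
theorem statement1 (K : Type*) [Field K] [CharZero K]
    (g : Type*) [LieRing g] [LieAlgebra K g] [FiniteDimensional K g]
    (h : Module.Dual K g →ₗ[K] g)
    (hsym : ∀ α β : Module.Dual K g, α (h β) = β (h α))
    (hequiv : ∀ (x : g) (α : Module.Dual K g),
      h (α ∘ₗ LieAlgebra.ad K g x) = -⁅x, h α⁆) :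
    (∀ (x : g) (α : Module.Dual K g),
        ⁅x, h α⁆ = h (-(α ∘ₗ LieAlgebra.ad K g x)) ∧
        ⁅x, h α⁆ ∈ LinearMap.range h) ∧
    (∃ B₀ : ↥(LinearMap.range h) →ₗ[K] ↥(LinearMap.range h) →ₗ[K] K,
      (∀ (α : Module.Dual K g) (y : ↥(LinearMap.range h)),
          B₀ ⟨h α, LinearMap.mem_range_self h α⟩ y = α (y : g)) ∧
      (∀ B' : ↥(LinearMap.range h) →ₗ[K] ↥(LinearMap.range h) →ₗ[K] K,
          (∀ (α : Module.Dual K g) (y : ↥(LinearMap.range h)),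
              B' ⟨h α, LinearMap.mem_range_self h α⟩ y = α (y : g)) → B' = B₀) ∧
      (∀ y z : ↥(LinearMap.range h), B₀ y z = B₀ z y) ∧
      (∀ y : ↥(LinearMap.range h), (∀ z : ↥(LinearMap.range h), B₀ y z = 0) → y = 0) ∧
      (∀ (x : g) (y z : ↥(LinearMap.range h))
          (hy : ⁅x, (y : g)⁆ ∈ LinearMap.range h)
          (hz : ⁅x, (z : g)⁆ ∈ LinearMap.range h),
          B₀ ⟨⁅x, (y : g)⁆, hy⟩ z + B₀ y ⟨⁅x, (z : g)⁆, hz⟩ = 0)) := by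
  have hbr : ∀ (x : g) (α : Module.Dual K g),
      h (-(α ∘ₗ LieAlgebra.ad K g x)) = ⁅x, h α⁆ := fun x α => by
    rw [map_neg, hequiv, neg_neg]
  refine ⟨fun x α => ⟨(hbr x α).symm, ⟨_, hbr x α⟩⟩, ?_⟩
  obtain ⟨s, hs⟩ := h.rangeRestrict.exists_rightInverse_of_surjective h.range_rangeRestrict
  have hs' : ∀ y : LinearMap.range h, h (s y) = y := fun y =>
    congrArg Subtype.val (LinearMap.congr_fun hs y)
  let B₀ : LinearMap.range h →ₗ[K] LinearMap.range h →ₗ[K] K :=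
    (LinearMap.lcomp K K (LinearMap.range h).subtype) ∘ₗ s
  have hB : ∀ (α : Module.Dual K g) (y : LinearMap.range h),
      B₀ ⟨h α, LinearMap.mem_range_self h α⟩ y = α (y : g) := by
    rintro α ⟨_, β, rfl⟩
    change s _ (h β) = α (h β)
    rw [hsym, hs', hsym]
  refine ⟨B₀, hB, ?_, ?_, ?_, ?_⟩
  · intro B' hB'
    ext ⟨_, α, rfl⟩ y
    rw [hB', hB]
  · rintro ⟨_, α, rfl⟩ ⟨_, β, rfl⟩
    rw [hB, hB, hsym]
  · rintro ⟨_, α, rfl⟩ hα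
    refine Subtype.ext ((Module.forall_dual_apply_eq_zero_iff K (h α)).mp fun β => ?_)
    rw [← hsym, ← hB α ⟨h β, LinearMap.mem_range_self h β⟩, hα]
  · rintro x ⟨_, α, rfl⟩ z hy hz
    have hx : (⟨⁅x, h α⁆, hy⟩ : LinearMap.range h) =
        ⟨h (-(α ∘ₗ LieAlgebra.ad K g x)), LinearMap.mem_range_self h _⟩ :=
      Subtype.ext (hbr x α).symm
    rw [hx, hB, hB]
    simp
end

section
/- For every linear map Φ : V₁ → V₂, every alternating bilinear form σ on V₁, and every Lagrangian subspace E ⊆ V₁ ⊕ V₁*, the (Φ,σ)-forward image E_{Φ,σ} = {(Φ(v), β) : v ∈ V₁, β ∈ V₂*, (v, Φ*(β) − σ♭(v)) ∈ E} is a Lagrangian subspace of V₂ ⊕ V₂*. -/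
/-- A subset `S` of `V ⊕ V*` is Lagrangian when it coincides with its own orthogonal
complement with respect to the canonical split symmetric bilinear form
`⟨(v,α),(w,β)⟩ = α w + β v`. -/
def IsLagrangian {K V : Type*} [Field K] [AddCommGroup V] [Module K V]
    (S : Set (V × Module.Dual K V)) : Prop :=
  ∀ y : V × Module.Dual K V, y ∈ S ↔ ∀ x ∈ S, x.2 y.1 + y.2 x.1 = 0

open Module in
/-- A Lagrangian subset, bundled as a subspace. -/
def IsLagrangian.toSubmodule {K V : Type*} [Field K] [AddCommGroup V] [Module K V]
    {S : Set (V × Dual K V)} (hS : IsLagrangian S) : Submodule K (V × Dual K V) where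
  carrier := S
  zero_mem' := (hS 0).2 fun x _ => by simp
  add_mem' {a b} ha hb := (hS _).2 fun x hx => by
    have h₁ := (hS a).1 ha x hx
    have h₂ := (hS b).1 hb x hx
    simp only [Prod.fst_add, Prod.snd_add, map_add, LinearMap.add_apply]
    linear_combination h₁ + h₂
  smul_mem' c a ha := (hS _).2 fun x hx => by
    have h := (hS a).1 ha x hx
    simp only [Prod.smul_fst, Prod.smul_snd, map_smul, LinearMap.smul_apply, smul_eq_mul]
    linear_combination c * h

open Module in
/-- The pairing of `(u, α)` with the element `(v, Φ* β - σ v)` determined by `(v, β)`. -/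
def forwardPairing {K V₁ V₂ : Type*} [Field K] [AddCommGroup V₁] [Module K V₁]
    [AddCommGroup V₂] [Module K V₂] (Φ : V₁ →ₗ[K] V₂) (σ : V₁ →ₗ[K] Dual K V₁) :
    (V₁ × Dual K V₁) →ₗ[K] Dual K (V₁ × Dual K V₂) :=
  LinearMap.mk₂ K (fun e q => e.2 q.1 + (q.2 (Φ e.1) - σ q.1 e.1))
    (fun _ _ _ => by simp; ring) (fun _ _ _ => by simp; ring)
    (fun _ _ _ => by simp; ring) (fun _ _ _ => by simp; ring)

/-- the `(Φ,σ)`-forward image of a Lagrangian subspace `E ⊆ V₁ ⊕ V₁*` is a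
Lagrangian subspace of `V₂ ⊕ V₂*`. -/
theorem statement4 (K V₁ V₂ : Type*) [Field K]
    [AddCommGroup V₁] [Module K V₁] [FiniteDimensional K V₁]
    [AddCommGroup V₂] [Module K V₂] [FiniteDimensional K V₂]
    (Φ : V₁ →ₗ[K] V₂) (σ : V₁ →ₗ[K] Module.Dual K V₁) (halt : ∀ v : V₁, σ v v = 0)
    (E : Set (V₁ × Module.Dual K V₁)) (hE : IsLagrangian E) :
    IsLagrangian {p : V₂ × Module.Dual K V₂ |
      ∃ (v : V₁) (β : Module.Dual K V₂), p = (Φ v, β) ∧ (v, Φ.dualMap β - σ v) ∈ E} := by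
  have hskew (v w : V₁) : σ v w + σ w v = 0 := by
    have h := halt (v + w)
    simp only [map_add, LinearMap.add_apply, halt] at h
    linear_combination h
  rintro ⟨w, γ⟩
  constructor
  · rintro ⟨u, γ', h, hu⟩ _ ⟨v, β, rfl, hv⟩
    obtain ⟨rfl, rfl⟩ := Prod.mk.inj h
    have h := (hE _).1 hu _ hv
    simp only [LinearMap.sub_apply, LinearMap.dualMap_apply] at h
    linear_combination h + hskew u v
  · intro h
    let W := hE.toSubmodule.map (forwardPairing Φ σ)
    let f : Module.Dual K (V₁ × Module.Dual K V₂) :=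
      LinearMap.coprod (γ ∘ₗ Φ) (Module.Dual.eval K V₂ w)
    have hf : f ∈ W := by
      rw [← Subspace.dualCoannihilator_dualAnnihilator_eq (W := W),
        Submodule.mem_dualAnnihilator]
      rintro ⟨v, β⟩ hq
      rw [Submodule.mem_dualCoannihilator] at hq
      have hv : (v, Φ.dualMap β - σ v) ∈ E := (hE _).2 fun e he => by
        simpa [forwardPairing] using hq _ (Submodule.mem_map_of_mem (p := hE.toSubmodule) he)
      have := h _ ⟨v, β, rfl, hv⟩
      simp only [f, LinearMap.coprod_apply, LinearMap.comp_apply, Module.Dual.eval_apply]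
      linear_combination this
    obtain ⟨⟨u, α⟩, hu, heq⟩ := hf
    have hw : w = Φ u := by
      refine (Module.forall_dual_apply_eq_zero_iff K (w - Φ u)).1 (fun β => ?_) |> sub_eq_zero.1
      have := LinearMap.congr_fun heq (0, β)
      simp [forwardPairing, f] at this
      simp [this]
    have hα : α = Φ.dualMap γ - σ u := by
      ext v
      have := LinearMap.congr_fun heq (v, 0)
      simp [forwardPairing, f] at this
      simp only [LinearMap.sub_apply, LinearMap.dualMap_apply]
      linear_combination this + hskew u v
    subst hw hα
    exact ⟨u, γ, rfl, hu⟩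
end

section
/- Let p : V ⊕ V* → V ⊕ V* be a linear map and let pᵗ denote its adjoint with respect to the canonical split bilinear form. If p + pᵗ = Id, then in the block decomposition of p the component p₁₂ : V* → V is skew (α(p₁₂(β)) = −β(p₁₂(α)) for all α, β ∈ V*, so p₁₂ is the adjoint of a skew-symmetric 2-tensor on V) and the component p₂₁ : V → V* is skew ((p₂₁(v))(w) = −(p₂₁(w))(v) for all v, w ∈ V, so p₂₁ is the adjoint of an alternating 2-form on V). If, in addition, p is idempotent, then E := range(p) and F := range(pᵗ) = ker(p) are Lagrangian subspaces and V ⊕ V* = E ⊕ F is a Lagrangian splitting. -/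
/-- The canonical split form on `V ⊕ V*` is nondegenerate. -/
theorem eq_zero_of_forall_split_form_eq_zero {K V : Type*} [Field K] [AddCommGroup V]
    [Module K V] {z : V × Module.Dual K V}
    (h : ∀ x : V × Module.Dual K V, x.2 z.1 + z.2 x.1 = 0) : z = 0 := by
  refine Prod.ext ?_ (LinearMap.ext fun v => ?_)
  · exact (Module.forall_dual_apply_eq_zero_iff K z.1).1 fun α => by simpa using h (0, α)
  · simpa using h (v, 0)

/-- If `q` is adjoint to `p` for the split form, `p + q = id` and `q ∘ p = 0`, then the range
of `p` is Lagrangian. -/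
theorem isLagrangian_range_of_adjoint {K V : Type*} [Field K] [AddCommGroup V] [Module K V]
    {p q : (V × Module.Dual K V) →ₗ[K] (V × Module.Dual K V)}
    (hadj : ∀ x y : V × Module.Dual K V,
      (p x).2 y.1 + y.2 (p x).1 = x.2 (q y).1 + (q y).2 x.1)
    (hsum : ∀ x, p x + q x = x) (hqp : ∀ x, q (p x) = 0) :
    IsLagrangian (↑(LinearMap.range p) : Set (V × Module.Dual K V)) := by
  refine fun y => ⟨?_, fun h => ?_⟩
  · rintro ⟨z, rfl⟩ _ ⟨x, rfl⟩
    simp [hadj, hqp]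
  · have hq : q y = 0 := eq_zero_of_forall_split_form_eq_zero fun x => by
      rw [← hadj]
      exact h _ ⟨x, rfl⟩
    exact ⟨y, by simpa [hq] using hsum y⟩

/-- if `p` is an endomorphism of `V ⊕ V*` with adjoint `pᵗ = q`
(with respect to the canonical split bilinear form) satisfying `p + pᵗ = Id`, then the
off-diagonal blocks `p₁₂ : V* → V` and `p₂₁ : V → V*` of `p` are skew; if moreover `p`
is idempotent, then `E := range p` and `F := range pᵗ = ker p` are Lagrangian subspaces
and `V ⊕ V* = E ⊕ F` is a Lagrangian splitting. -/
theorem statement6 (K V : Type*) [Field K] [AddCommGroup V] [Module K V]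
    [FiniteDimensional K V]
    (p q : (V × Module.Dual K V) →ₗ[K] (V × Module.Dual K V))
    (hadj : ∀ x y : V × Module.Dual K V,
      (p x).2 y.1 + y.2 (p x).1 = x.2 (q y).1 + (q y).2 x.1)
    (hsum : p + q = LinearMap.id) :
    ((∀ α β : Module.Dual K V, α (p ((0 : V), β)).1 = - β (p ((0 : V), α)).1) ∧
     (∀ v w : V, (p (v, (0 : Module.Dual K V))).2 w = - (p (w, (0 : Module.Dual K V))).2 v)) ∧
    (p ∘ₗ p = p →
      IsLagrangian (↑(LinearMap.range p) : Set (V × Module.Dual K V)) ∧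
      IsLagrangian (↑(LinearMap.range q) : Set (V × Module.Dual K V)) ∧
      LinearMap.range q = LinearMap.ker p ∧
      IsCompl (LinearMap.range p) (LinearMap.range q)) := by
  have hs : ∀ x, p x + q x = x := fun x => LinearMap.congr_fun hsum x
  have hq : ∀ x, q x = x - p x := fun x => eq_sub_of_add_eq' (hs x)
  refine ⟨⟨fun α β => ?_, fun v w => ?_⟩, fun hp => ?_⟩
  · have h := hadj (0, α) (0, β)
    simp only [hq, Prod.fst_sub, Prod.snd_sub, map_zero, map_sub] at h
    linear_combination h
  · have h := hadj (v, 0) (w, 0)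
    simp only [hq, Prod.fst_sub, Prod.snd_sub, LinearMap.zero_apply, LinearMap.sub_apply] at h
    linear_combination h
  have hpp : ∀ x, p (p x) = p x := fun x => LinearMap.congr_fun hp x
  have hqp : ∀ x, q (p x) = 0 := fun x => by rw [hq, hpp, sub_self]
  have hpq : ∀ x, p (q x) = 0 := fun x => by rw [hq, map_sub, hpp, sub_self]
  have hrange : LinearMap.range q = LinearMap.ker p := by
    ext x
    refine ⟨?_, fun hx => ⟨x, ?_⟩⟩
    · rintro ⟨y, rfl⟩
      exact hpq y
    · rw [hq, LinearMap.mem_ker.1 hx, sub_zero]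
  refine ⟨isLagrangian_range_of_adjoint hadj hs hqp,
    isLagrangian_range_of_adjoint (fun x y => by linear_combination -hadj y x)
      (fun x => by rw [add_comm, hs]) hpq,
    hrange, ?_⟩
  rw [hrange]
  exact LinearMap.IsIdempotentElem.isCompl hp
end

section
/- Let V, W, g be finite-dimensional K-vector spaces, L, R : g → W linear isomorphisms, D : V → W and fund : g → V linear maps, and set ρ := fund ∘ (L⁻¹ − R⁻¹) ∘ D : V → V. Let σ be an alternating bilinear form on V with adjoint σ♭ and P♯ : V* → V a skew linear map, and suppose they are dual to each other: P♯ ∘ σ♭ = Id_V − (1/4)ρ. Then: (a) the map V* ⊕ g → V, (α, ξ) ↦ P♯(α) + fund(ξ), is surjective (P is quasi non-degenerate); and (b) the map V ⊕ W* → V*, (X, β) ↦ σ♭(X) + D*(β), is surjective, where D* : W* → V* is the dual map (equivalently, (σ♭, D) : V → V* ⊕ W is injective, i.e. σ is Φ-non-degenerate). -/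
/-- if the alternating form `σ` and the skew map `P♯` are dual to each
other via `P♯ ∘ σ♭ = Id − (1/4)ρ`, with `ρ = fund ∘ (L⁻¹ − R⁻¹) ∘ D`, then
(a) `(α, ξ) ↦ P♯ α + fund ξ` is surjective (`P` is quasi non-degenerate), and
(b) `(X, β) ↦ σ♭ X + D* β` is surjective (equivalently `X ↦ (σ♭ X, D X)` is injective,
i.e. `σ` is `Φ`-non-degenerate). -/
theorem statement10 (K V W g : Type*) [Field K] [CharZero K]
    [AddCommGroup V] [Module K V] [FiniteDimensional K V]
    [AddCommGroup W] [Module K W] [FiniteDimensional K W]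
    [AddCommGroup g] [Module K g] [FiniteDimensional K g]
    (L R : g ≃ₗ[K] W) (D : V →ₗ[K] W) (fund : g →ₗ[K] V)
    (σ : V →ₗ[K] Module.Dual K V) (halt : ∀ v : V, σ v v = 0)
    (P : Module.Dual K V →ₗ[K] V)
    (hskew : ∀ α β : Module.Dual K V, α (P β) = - β (P α))
    (hdual : P ∘ₗ σ = LinearMap.id -
      (4 : K)⁻¹ • (fund ∘ₗ ((L.symm : W →ₗ[K] g) - (R.symm : W →ₗ[K] g)) ∘ₗ D)) :
    Function.Surjective (fun z : Module.Dual K V × g => P z.1 + fund z.2) ∧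
    Function.Surjective (fun z : V × Module.Dual K W => σ z.1 + D.dualMap z.2) ∧
    Function.Injective (fun X : V => (σ X, D X)) := by
  have hrec (v : V) :
      v = P (σ v) + fund ((4 : K)⁻¹ • (L.symm (D v) - R.symm (D v))) := by
    have h := LinearMap.congr_fun hdual v
    simp only [LinearMap.comp_apply, LinearMap.sub_apply, LinearMap.smul_apply,
      LinearMap.id_apply, LinearEquiv.coe_coe] at h
    rw [h, map_smul, sub_add_cancel]
  have hneg (v w : V) : σ v w = -σ w v := (LinearMap.IsAlt.neg (B := σ) halt w v).symm
  refine ⟨fun v => ⟨(σ v, (4 : K)⁻¹ • (L.symm (D v) - R.symm (D v))), (hrec v).symm⟩,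
    fun α => ⟨(P α, (4 : K)⁻¹ •
      (α ∘ₗ fund ∘ₗ ((L.symm : W →ₗ[K] g) - (R.symm : W →ₗ[K] g)))), ?_⟩, ?_⟩
  · ext v
    have h := congrArg α (hrec v)
    rw [map_add, hskew, ← hneg, map_smul, map_smul] at h
    simpa using h.symm
  · intro X Y hXY
    obtain ⟨hσ, hD⟩ := Prod.mk.inj hXY
    rw [hrec X, hrec Y, hσ, hD]
end

section
/- Suppose the alternating bilinear form σ on V satisfies the σ-momentum condition. Let A := L⁻¹ ∘ R. Then: (a) for every ξ ∈ g with ξ + A(ξ) = 0 one has fund(ξ) ∈ ker σ♭, and the restriction of fund to ker(Id_g + A) is injective; (b) for every X ∈ ker σ♭ one has (L⁻¹ + R⁻¹)(D(X)) = 0, and the restriction of D gives a surjection ker σ♭ → ker(L⁻¹ + R⁻¹ : W → g); (c) on ker(Id_g + A) one has D ∘ fund = 2L, and 2L restricts to a bijection from ker(Id_g + A) onto ker(L⁻¹ + R⁻¹ : W → g). -/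
theorem add_symm_apply_eq_zero_iff {K W g : Type*} [Ring K]
    [AddCommGroup W] [Module K W] [AddCommGroup g] [Module K g]
    (L R : g ≃ₗ[K] W) (ξ : g) : ξ + L.symm (R ξ) = 0 ↔ R ξ = -L ξ := by
  rw [add_comm, add_eq_zero_iff_eq_neg, LinearEquiv.symm_apply_eq, map_neg]

theorem exists_two_smul_eq_of_symm_add_symm_eq_zero {K W g : Type*} [Field K] [CharZero K]
    [AddCommGroup W] [Module K W] [AddCommGroup g] [Module K g]
    (L R : g ≃ₗ[K] W) {w : W} (hw : L.symm w + R.symm w = 0) :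
    ∃ ξ : g, ξ + L.symm (R ξ) = 0 ∧ (2 : K) • L ξ = w := by
  have hR : R (L.symm w) = -w := by
    rw [add_eq_zero_iff_eq_neg.mp hw, map_neg, LinearEquiv.apply_symm_apply]
  refine ⟨(2 : K)⁻¹ • L.symm w, ?_, ?_⟩
  · rw [add_symm_apply_eq_zero_iff, map_smul, map_smul, hR, LinearEquiv.apply_symm_apply, smul_neg]
  · rw [map_smul, LinearEquiv.apply_symm_apply, smul_inv_smul₀ two_ne_zero]


/-- fiberwise version of Proposition "tech": for an alternating form `σ`
satisfying the σ-momentum condition, with `A := L⁻¹ ∘ R`: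
(a) `fund` maps `ker(Id + A)` into `ker σ♭`, injectively;
(b) `D` maps `ker σ♭` onto `ker(L⁻¹ + R⁻¹)`;
(c) on `ker(Id + A)` one has `D ∘ fund = 2L`, and `2L` restricts to a bijection from
`ker(Id + A)` onto `ker(L⁻¹ + R⁻¹)`. -/
theorem statement11 (K V W g : Type*) [Field K] [CharZero K]
    [AddCommGroup V] [Module K V] [FiniteDimensional K V]
    [AddCommGroup W] [Module K W] [FiniteDimensional K W]
    [AddCommGroup g] [Module K g] [FiniteDimensional K g]
    (L R : g ≃ₗ[K] W) (D : V →ₗ[K] W) (fund : g →ₗ[K] V)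
    (hDfund : ∀ ξ : g, D (fund ξ) = L ξ - R ξ)
    (ψ : g ≃ₗ[K] Module.Dual K g)
    (hψsym : ∀ x y : g, ψ x y = ψ y x)
    (horth : ∀ ξ η : g, ψ (L.symm (R ξ)) (L.symm (R η)) = ψ ξ η)
    (σ : V →ₗ[K] Module.Dual K V) (halt : ∀ v : V, σ v v = 0)
    (hmom : ∀ (ξ : g) (X : V),
      σ (fund ξ) X = (2 : K)⁻¹ * ψ ξ (L.symm (D X) + R.symm (D X))) :
    ((∀ ξ : g, ξ + L.symm (R ξ) = 0 → σ (fund ξ) = 0) ∧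
     (∀ ξ η : g, ξ + L.symm (R ξ) = 0 → η + L.symm (R η) = 0 →
        fund ξ = fund η → ξ = η)) ∧
    ((∀ X : V, σ X = 0 → L.symm (D X) + R.symm (D X) = 0) ∧
     (∀ w : W, L.symm w + R.symm w = 0 → ∃ X : V, σ X = 0 ∧ D X = w)) ∧
    ((∀ ξ : g, ξ + L.symm (R ξ) = 0 → D (fund ξ) = (2 : K) • L ξ) ∧
     (∀ ξ : g, ξ + L.symm (R ξ) = 0 →
        L.symm ((2 : K) • L ξ) + R.symm ((2 : K) • L ξ) = 0) ∧
     (∀ ξ η : g, ξ + L.symm (R ξ) = 0 → η + L.symm (R η) = 0 →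
        (2 : K) • L ξ = (2 : K) • L η → ξ = η) ∧
     (∀ w : W, L.symm w + R.symm w = 0 →
        ∃ ξ : g, ξ + L.symm (R ξ) = 0 ∧ (2 : K) • L ξ = w)) := by
  have fund_mem_ker : ∀ ξ : g, ξ + L.symm (R ξ) = 0 → σ (fund ξ) = 0 := by
    intro ξ hξ
    ext X
    have h := horth ξ (R.symm (D X))
    rw [LinearEquiv.apply_symm_apply, eq_neg_of_add_eq_zero_right hξ, map_neg,
      LinearMap.neg_apply] at h
    rw [hmom, map_add, ← h, add_neg_cancel, mul_zero, LinearMap.zero_apply]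
  have D_fund : ∀ ξ : g, ξ + L.symm (R ξ) = 0 → D (fund ξ) = (2 : K) • L ξ := by
    intro ξ hξ
    rw [hDfund, (add_symm_apply_eq_zero_iff L R ξ).mp hξ, sub_neg_eq_add, two_smul]
  have two_smul_injective : ∀ ξ η : g, (2 : K) • L ξ = (2 : K) • L η → ξ = η :=
    fun ξ η h => L.injective (smul_right_injective W (two_ne_zero : (2 : K) ≠ 0) h)
  refine ⟨⟨fund_mem_ker, fun ξ η hξ hη h => ?_⟩, ⟨fun X hX => ?_, fun w hw => ?_⟩,
    D_fund, fun ξ hξ => ?_, fun ξ η _ _ => two_smul_injective ξ η,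
    fun w hw => exists_two_smul_eq_of_symm_add_symm_eq_zero L R hw⟩
  · exact two_smul_injective ξ η (by rw [← D_fund ξ hξ, ← D_fund η hη, h])
  · refine ψ.map_eq_zero_iff.mp (LinearMap.ext fun ξ => ?_)
    have h := hmom ξ X
    rw [← LinearMap.IsAlt.neg halt X (fund ξ), hX, LinearMap.zero_apply, neg_zero] at h
    rw [hψsym, LinearMap.zero_apply]
    exact (mul_eq_zero.mp h.symm).resolve_left (inv_ne_zero two_ne_zero)
  · obtain ⟨ξ, hξ, rfl⟩ := exists_two_smul_eq_of_symm_add_symm_eq_zero L R hw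
    exact ⟨fund ξ, fund_mem_ker ξ hξ, D_fund ξ hξ⟩
  · have h : R.symm (L ξ) = -ξ := by
      rw [LinearEquiv.symm_apply_eq, map_neg, (add_symm_apply_eq_zero_iff L R ξ).mp hξ, neg_neg]
    rw [map_smul, map_smul, LinearEquiv.symm_apply_apply, h, smul_neg, add_neg_cancel]
end

section
/- Suppose the alternating bilinear form σ on V satisfies the σ-momentum condition, and let A := L⁻¹ ∘ R. Then the following six conditions are pairwise equivalent: (1) the restriction of fund maps ker(Id_g + A) onto ker σ♭; (2) the restriction of fund is a bijection from ker(Id_g + A) onto ker σ♭; (3) ker σ♭ ∩ ker D = 0; (4) σ is Φ-non-degenerate, i.e. X ↦ (σ♭(X), D(X)) is injective; (5) the restriction of D to ker σ♭ is an injection into ker(L⁻¹ + R⁻¹ : W → g); (6) the restriction of D is a bijection from ker σ♭ onto ker(L⁻¹ + R⁻¹ : W → g). -/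
/-- fiberwise version of Proposition "nondegqh": for an alternating form
`σ` satisfying the σ-momentum condition, with `A := L⁻¹ ∘ R`, six non-degeneracy
conditions are pairwise equivalent. -/
theorem statement12 (K V W g : Type*) [Field K] [CharZero K]
    [AddCommGroup V] [Module K V] [FiniteDimensional K V]
    [AddCommGroup W] [Module K W] [FiniteDimensional K W]
    [AddCommGroup g] [Module K g] [FiniteDimensional K g]
    (L R : g ≃ₗ[K] W) (D : V →ₗ[K] W) (fund : g →ₗ[K] V)
    (hDfund : ∀ ξ : g, D (fund ξ) = L ξ - R ξ)
    (ψ : g ≃ₗ[K] Module.Dual K g)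
    (hψsym : ∀ x y : g, ψ x y = ψ y x)
    (horth : ∀ ξ η : g, ψ (L.symm (R ξ)) (L.symm (R η)) = ψ ξ η)
    (σ : V →ₗ[K] Module.Dual K V) (halt : ∀ v : V, σ v v = 0)
    (hmom : ∀ (ξ : g) (X : V),
      σ (fund ξ) X = (2 : K)⁻¹ * ψ ξ (L.symm (D X) + R.symm (D X))) :
    [(⇑fund '' {ξ : g | ξ + L.symm (R ξ) = 0} = {X : V | σ X = 0}),
     (Set.InjOn ⇑fund {ξ : g | ξ + L.symm (R ξ) = 0} ∧
        ⇑fund '' {ξ : g | ξ + L.symm (R ξ) = 0} = {X : V | σ X = 0}),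
     (∀ X : V, σ X = 0 → D X = 0 → X = 0),
     Function.Injective (fun X : V => (σ X, D X)),
     (Set.InjOn ⇑D {X : V | σ X = 0} ∧
        ⇑D '' {X : V | σ X = 0} ⊆ {w : W | L.symm w + R.symm w = 0}),
     (Set.InjOn ⇑D {X : V | σ X = 0} ∧
        ⇑D '' {X : V | σ X = 0} = {w : W | L.symm w + R.symm w = 0})].TFAE := by
  have h_two : (2 : K) ≠ 0 := two_ne_zero
  have hskew : ∀ X Y : V, σ X Y = -σ Y X := fun X Y => by
    have h := halt (X + Y)
    simp only [map_add, LinearMap.add_apply, halt, zero_add, add_zero] at h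
    exact eq_neg_of_add_eq_zero_right h
  have hDker : ∀ X : V, σ X = 0 → L.symm (D X) + R.symm (D X) = 0 := fun X hX => by
    refine ψ.map_eq_zero_iff.1 (LinearMap.ext fun ξ => ?_)
    have h := hmom ξ X
    rw [hskew, hX, LinearMap.zero_apply, neg_zero, eq_comm, mul_eq_zero] at h
    rw [hψsym]
    exact h.resolve_left (inv_ne_zero h_two)
  have hfundker : ∀ ξ : g, ξ + L.symm (R ξ) = 0 → σ (fund ξ) = 0 := fun ξ hξ => by
    refine LinearMap.ext fun X => ?_
    have h := horth ξ (R.symm (D X))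
    rw [LinearEquiv.apply_symm_apply] at h
    rw [hmom, map_add, ← h, ← LinearMap.add_apply, ← map_add, hξ]
    simp
  have hDfundker : ∀ ξ : g, ξ + L.symm (R ξ) = 0 → D (fund ξ) = (2 : K) • L ξ := fun ξ hξ => by
    have h := congrArg L hξ
    rw [map_add, LinearEquiv.apply_symm_apply, map_zero] at h
    rw [hDfund, eq_neg_of_add_eq_zero_right h, two_smul, sub_neg_eq_add]
  have hfundzero : ∀ ξ : g, ξ + L.symm (R ξ) = 0 → D (fund ξ) = 0 → ξ = 0 := fun ξ hξ h => by
    rw [hDfundker ξ hξ] at h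
    exact L.map_eq_zero_iff.1 ((smul_eq_zero.1 h).resolve_left h_two)
  have hinj : Set.InjOn ⇑fund {ξ : g | ξ + L.symm (R ξ) = 0} := fun ξ hξ η hη h => by
    simp only [Set.mem_ofPred_eq] at hξ hη
    refine sub_eq_zero.1 (hfundzero _ ?_ ?_)
    · rw [map_sub, map_sub, sub_add_sub_comm, hξ, hη, sub_zero]
    · rw [map_sub, h, sub_self, map_zero]
  have hsurj : ∀ w : W, L.symm w + R.symm w = 0 →
      ∃ ξ : g, ξ + L.symm (R ξ) = 0 ∧ D (fund ξ) = w := fun w hw => by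
    have hξ : (2 : K)⁻¹ • L.symm w + L.symm (R ((2 : K)⁻¹ • L.symm w)) = 0 := by
      rw [map_smul, map_smul, ← smul_add, eq_neg_of_add_eq_zero_left hw, map_neg,
        LinearEquiv.apply_symm_apply, map_neg, ← neg_add, add_comm, hw, neg_zero, smul_zero]
    refine ⟨_, hξ, ?_⟩
    rw [hDfundker _ hξ, map_smul, LinearEquiv.apply_symm_apply, smul_smul,
      mul_inv_cancel₀ h_two, one_smul]
  have hDsub : ⇑D '' {X : V | σ X = 0} ⊆ {w : W | L.symm w + R.symm w = 0} := by
    rintro _ ⟨X, hX, rfl⟩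
    exact hDker X hX
  have hDeq : ⇑D '' {X : V | σ X = 0} = {w : W | L.symm w + R.symm w = 0} := by
    refine hDsub.antisymm fun w hw => ?_
    obtain ⟨ξ, hξ, rfl⟩ := hsurj w hw
    exact ⟨fund ξ, hfundker ξ hξ, rfl⟩
  tfae_have 1 ↔ 2 := ⟨fun h => ⟨hinj, h⟩, And.right⟩
  tfae_have 5 ↔ 6 := ⟨fun h => ⟨h.1, hDeq⟩, fun h => ⟨h.1, hDsub⟩⟩
  tfae_have 1 → 3 := by
    intro h X hX hDX
    obtain ⟨ξ, hξ, rfl⟩ := h.ge hX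
    rw [hfundzero ξ hξ hDX, map_zero]
  tfae_have 3 → 1 := by
    intro h
    refine Set.Subset.antisymm ?_ fun X hX => ?_
    · rintro _ ⟨ξ, hξ, rfl⟩
      exact hfundker ξ hξ
    · obtain ⟨ξ, hξ, hD⟩ := hsurj (D X) (hDker X hX)
      refine ⟨ξ, hξ, sub_eq_zero.1 (h _ ?_ ?_)⟩
      · rw [map_sub, hfundker ξ hξ, Set.mem_ofPred.1 hX, sub_zero]
      · rw [map_sub, hD, sub_self]
  tfae_have 3 ↔ 4 := by
    refine Iff.trans ?_ (injective_iff_map_eq_zero (σ.prod D)).symm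
    simp
  tfae_have 3 → 5 := by
    refine fun h => ⟨fun X hX Y hY hXY => sub_eq_zero.1 (h _ ?_ ?_), hDsub⟩
    · rw [map_sub, Set.mem_ofPred.1 hX, Set.mem_ofPred.1 hY, sub_zero]
    · rw [map_sub, hXY, sub_self]
  tfae_have 5 → 3 := fun h X hX hDX =>
    h.1 hX (map_zero σ) (hDX.trans (map_zero D).symm)
  tfae_finish
end

section
/- Suppose the skew linear map P♯ : V* → V satisfies the P-momentum condition. Then: (a) for every γ ∈ W* with L*(γ) + R*(γ) = 0 one has D*(γ) ∈ ker P♯, and the restriction of D* to ker(L* + R* : W* → g*) is injective; (b) for every α ∈ ker P♯ one has fund*(α) ∈ ker((L⁻¹)* + (R⁻¹)* : g* → W*), and the restriction of fund* gives a surjection ker P♯ → ker((L⁻¹)* + (R⁻¹)*); (c) on ker(L* + R*) one has fund* ∘ D* = 2L*, and 2L* restricts to a bijection from ker(L* + R* : W* → g*) onto ker((L⁻¹)* + (R⁻¹)* : g* → W*). Here fund* : V* → g*, D* : W* → V*, L*, R* : W* → g*, and (L⁻¹)*, (R⁻¹)* : g* → W* denote the dual maps. -/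
/-- fiberwise version of Proposition "techP": for a skew map `P♯`
satisfying the P-momentum condition:
(a) `D*` maps `ker(L* + R*)` into `ker P♯`, injectively;
(b) `fund*` maps `ker P♯` onto `ker((L⁻¹)* + (R⁻¹)*)`;
(c) on `ker(L* + R*)` one has `fund* ∘ D* = 2L*`, and `2L*` restricts to a bijection
from `ker(L* + R*)` onto `ker((L⁻¹)* + (R⁻¹)*)`. -/
theorem statement13 (K V W g : Type*) [Field K] [CharZero K]
    [AddCommGroup V] [Module K V] [FiniteDimensional K V]
    [AddCommGroup W] [Module K W] [FiniteDimensional K W]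
    [AddCommGroup g] [Module K g] [FiniteDimensional K g]
    (L R : g ≃ₗ[K] W) (D : V →ₗ[K] W) (fund : g →ₗ[K] V)
    (hDfund : ∀ ξ : g, D (fund ξ) = L ξ - R ξ)
    (ψ : g ≃ₗ[K] Module.Dual K g)
    (hψsym : ∀ x y : g, ψ x y = ψ y x)
    (horth : ∀ ξ η : g, ψ (L.symm (R ξ)) (L.symm (R η)) = ψ ξ η)
    (P : Module.Dual K V →ₗ[K] V)
    (hskew : ∀ α β : Module.Dual K V, α (P β) = - β (P α))
    (hPmom : ∀ γ : Module.Dual K W,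
      (2 : K) • P (D.dualMap γ) =
        fund (ψ.symm ((L : g →ₗ[K] W).dualMap γ + (R : g →ₗ[K] W).dualMap γ))) :
    ((∀ γ : Module.Dual K W,
        (L : g →ₗ[K] W).dualMap γ + (R : g →ₗ[K] W).dualMap γ = 0 →
        P (D.dualMap γ) = 0) ∧
     (∀ γ γ' : Module.Dual K W,
        (L : g →ₗ[K] W).dualMap γ + (R : g →ₗ[K] W).dualMap γ = 0 →
        (L : g →ₗ[K] W).dualMap γ' + (R : g →ₗ[K] W).dualMap γ' = 0 →
        D.dualMap γ = D.dualMap γ' → γ = γ')) ∧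
    ((∀ α : Module.Dual K V, P α = 0 →
        (L.symm : W →ₗ[K] g).dualMap (fund.dualMap α) +
          (R.symm : W →ₗ[K] g).dualMap (fund.dualMap α) = 0) ∧
     (∀ μ : Module.Dual K g,
        (L.symm : W →ₗ[K] g).dualMap μ + (R.symm : W →ₗ[K] g).dualMap μ = 0 →
        ∃ α : Module.Dual K V, P α = 0 ∧ fund.dualMap α = μ)) ∧
    ((∀ γ : Module.Dual K W,
        (L : g →ₗ[K] W).dualMap γ + (R : g →ₗ[K] W).dualMap γ = 0 →
        fund.dualMap (D.dualMap γ) = (2 : K) • (L : g →ₗ[K] W).dualMap γ) ∧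
     (∀ γ : Module.Dual K W,
        (L : g →ₗ[K] W).dualMap γ + (R : g →ₗ[K] W).dualMap γ = 0 →
        (L.symm : W →ₗ[K] g).dualMap ((2 : K) • (L : g →ₗ[K] W).dualMap γ) +
          (R.symm : W →ₗ[K] g).dualMap ((2 : K) • (L : g →ₗ[K] W).dualMap γ) = 0) ∧
     (∀ γ γ' : Module.Dual K W,
        (L : g →ₗ[K] W).dualMap γ + (R : g →ₗ[K] W).dualMap γ = 0 →
        (L : g →ₗ[K] W).dualMap γ' + (R : g →ₗ[K] W).dualMap γ' = 0 →
        (2 : K) • (L : g →ₗ[K] W).dualMap γ = (2 : K) • (L : g →ₗ[K] W).dualMap γ' →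
        γ = γ') ∧
     (∀ μ : Module.Dual K g,
        (L.symm : W →ₗ[K] g).dualMap μ + (R.symm : W →ₗ[K] g).dualMap μ = 0 →
        ∃ γ : Module.Dual K W,
          (L : g →ₗ[K] W).dualMap γ + (R : g →ₗ[K] W).dualMap γ = 0 ∧
          (2 : K) • (L : g →ₗ[K] W).dualMap γ = μ)) := by
  have two_ne : (2 : K) ≠ 0 := two_ne_zero
  have ker_apply : ∀ γ : Module.Dual K W,
      (L : g →ₗ[K] W).dualMap γ + (R : g →ₗ[K] W).dualMap γ = 0 →
      ∀ ξ, γ (L ξ) + γ (R ξ) = 0 := fun γ hγ ξ => by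
    simpa using LinearMap.congr_fun hγ ξ
  have map_ker : ∀ γ : Module.Dual K W,
      (L : g →ₗ[K] W).dualMap γ + (R : g →ₗ[K] W).dualMap γ = 0 →
      P (D.dualMap γ) = 0 := fun γ hγ => by
    have h := hPmom γ
    rw [hγ, map_zero, map_zero] at h
    exact (smul_eq_zero.mp h).resolve_left two_ne
  have fund_D : ∀ γ : Module.Dual K W,
      (L : g →ₗ[K] W).dualMap γ + (R : g →ₗ[K] W).dualMap γ = 0 →
      fund.dualMap (D.dualMap γ) = (2 : K) • (L : g →ₗ[K] W).dualMap γ := fun γ hγ => by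
    ext ξ
    have h := ker_apply γ hγ ξ
    simp only [LinearMap.dualMap_apply, hDfund, map_sub, LinearMap.smul_apply, smul_eq_mul,
      LinearEquiv.coe_coe]
    linear_combination -h
  have two_L_inj : ∀ γ γ' : Module.Dual K W,
      (2 : K) • (L : g →ₗ[K] W).dualMap γ = (2 : K) • (L : g →ₗ[K] W).dualMap γ' →
      γ = γ' := fun γ γ' h => by
    ext w
    simpa using LinearMap.congr_fun (smul_right_injective _ two_ne h) (L.symm w)
  have two_L_surj : ∀ μ : Module.Dual K g,
      (L.symm : W →ₗ[K] g).dualMap μ + (R.symm : W →ₗ[K] g).dualMap μ = 0 →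
      ∃ γ : Module.Dual K W,
        (L : g →ₗ[K] W).dualMap γ + (R : g →ₗ[K] W).dualMap γ = 0 ∧
        (2 : K) • (L : g →ₗ[K] W).dualMap γ = μ := fun μ hμ => by
    refine ⟨(2 : K)⁻¹ • (L.symm : W →ₗ[K] g).dualMap μ, ?_, ?_⟩
    · ext ξ
      have h : μ (L.symm (R ξ)) + μ ξ = 0 := by simpa using LinearMap.congr_fun hμ (R ξ)
      simp only [map_smul, LinearMap.add_apply, LinearMap.smul_apply, LinearMap.dualMap_apply,
        LinearEquiv.coe_coe, LinearEquiv.symm_apply_apply, smul_eq_mul, LinearMap.zero_apply]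
      linear_combination (2 : K)⁻¹ * h
    · ext ξ
      simp
  refine ⟨⟨map_ker, fun γ γ' hγ hγ' h => ?_⟩, ⟨fun α hα => ?_, fun μ hμ => ?_⟩,
    fund_D, fun γ hγ => ?_, fun γ γ' _ _ h => two_L_inj γ γ' h, two_L_surj⟩
  · exact two_L_inj γ γ' (by rw [← fund_D γ hγ, ← fund_D γ' hγ', h])
  · obtain ⟨x, hx⟩ := ψ.surjective (fund.dualMap α)
    have hLR : L x + R x = 0 := by
      refine (Module.forall_dual_apply_eq_zero_iff K _).mp fun γ => ?_
      have h := congrArg α (hPmom γ)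
      rw [map_smul, hskew, hα, map_zero, neg_zero, smul_zero, ← LinearMap.dualMap_apply, ← hx,
        hψsym, LinearEquiv.apply_symm_apply] at h
      simpa using h.symm
    have hA : L.symm (R x) = -x := by
      rw [← neg_eq_of_add_eq_zero_right hLR, map_neg, LinearEquiv.symm_apply_apply]
    rw [← hx]
    ext w
    have h := horth x (R.symm w)
    rw [hA, LinearEquiv.apply_symm_apply, map_neg, LinearMap.neg_apply] at h
    simp only [LinearMap.add_apply, LinearMap.dualMap_apply, LinearEquiv.coe_coe,
      LinearMap.zero_apply]
    linear_combination -h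
  · obtain ⟨γ, hγ, rfl⟩ := two_L_surj μ hμ
    exact ⟨D.dualMap γ, map_ker γ hγ, fund_D γ hγ⟩
  · ext w
    have h := ker_apply γ hγ (R.symm w)
    rw [LinearEquiv.apply_symm_apply] at h
    simp only [LinearMap.add_apply, LinearMap.dualMap_apply, LinearEquiv.coe_coe, map_smul,
      LinearMap.smul_apply, LinearEquiv.apply_symm_apply, smul_eq_mul, LinearMap.zero_apply]
    linear_combination 2 * h
end

section
/- Suppose the skew linear map P♯ : V* → V satisfies the P-momentum condition. Then the following six conditions are pairwise equivalent: (1) the restriction of D* maps ker(L* + R* : W* → g*) onto ker P♯; (2) the restriction of D* is a bijection from ker(L* + R*) onto ker P♯; (3) ker P♯ ∩ ker(fund* : V* → g*) = 0; (4) P is quasi non-degenerate, i.e. (α, ξ) ↦ P♯(α) + fund(ξ) is surjective onto V; (5) the restriction of fund* to ker P♯ is an injection into ker((L⁻¹)* + (R⁻¹)* : g* → W*); (6) the restriction of fund* is a bijection from ker P♯ onto ker((L⁻¹)* + (R⁻¹)*). -/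
section FiberwisePoisson

variable {K V W g : Type*} [Field K] [AddCommGroup V] [Module K V]
  [AddCommGroup W] [Module K W] [AddCommGroup g] [Module K g]

/-- For a skew map `P`, the map `(α, ξ) ↦ P α + f ξ` is onto if and only if
`ker P` and `ker f*` intersect trivially. -/
theorem surjective_add_iff_of_skew (f : g →ₗ[K] V) (P : Module.Dual K V →ₗ[K] V)
    (hskew : ∀ α β : Module.Dual K V, α (P β) = - β (P α)) :
    Function.Surjective (fun z : Module.Dual K V × g => P z.1 + f z.2) ↔
      ∀ α : Module.Dual K V, P α = 0 → f.dualMap α = 0 → α = 0 := by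
  constructor
  · intro hsurj α hP hf
    ext v
    obtain ⟨⟨β, ξ⟩, rfl⟩ := hsurj v
    have hfξ : α (f ξ) = 0 := LinearMap.congr_fun hf ξ
    simp [hskew α β, hP, hfξ]
  · intro h
    suffices hrange : LinearMap.range (P.coprod f) = ⊤ from LinearMap.range_eq_top.1 hrange
    by_contra hne
    obtain ⟨α, hα, hle⟩ := Submodule.exists_le_ker_of_lt_top _ (lt_top_iff_ne_top.2 hne)
    have hzero : ∀ (β : Module.Dual K V) (ξ : g), α (P β + f ξ) = 0 := fun β ξ =>
      hle ⟨(β, ξ), rfl⟩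
    refine hα (h α ?_ ?_)
    · refine (Module.forall_dual_apply_eq_zero_iff K _).1 fun β => ?_
      simpa [hskew β α] using hzero β 0
    · ext ξ
      simpa using hzero 0 ξ

/-- If `B(A ξ, A η) = B(ξ, η)` for `A = L⁻¹ ∘ R` and `L x + R x = 0`, then the covector `B(x, ·)`
lies in the kernel of `(L⁻¹)* + (R⁻¹)*`. -/
theorem dualMap_symm_add_eq_zero_of_orthogonal (L R : g ≃ₗ[K] W) (ψ : g →ₗ[K] Module.Dual K g)
    (horth : ∀ ξ η : g, ψ (L.symm (R ξ)) (L.symm (R η)) = ψ ξ η)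
    {x : g} (hx : L x + R x = 0) :
    (L.symm : W →ₗ[K] g).dualMap (ψ x) + (R.symm : W →ₗ[K] g).dualMap (ψ x) = 0 := by
  have hA : L.symm (R x) = -x := by
    rw [eq_neg_of_add_eq_zero_right hx, map_neg, L.symm_apply_apply]
  ext w
  have h := horth x (R.symm w)
  rw [hA, R.apply_symm_apply, map_neg, LinearMap.neg_apply] at h
  simp [← h]

/-- The momentum condition and skewness force `f*` to map `ker P` into the kernel of
`(L⁻¹)* + (R⁻¹)*`. -/
theorem dualMap_symm_add_eq_zero_of_momentum (L R : g ≃ₗ[K] W) (D : V →ₗ[K] W)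
    (f : g →ₗ[K] V) (ψ : g ≃ₗ[K] Module.Dual K g) (hψsym : ∀ x y : g, ψ x y = ψ y x)
    (horth : ∀ ξ η : g, ψ (L.symm (R ξ)) (L.symm (R η)) = ψ ξ η)
    (P : Module.Dual K V →ₗ[K] V)
    (hskew : ∀ α β : Module.Dual K V, α (P β) = - β (P α))
    (hPmom : ∀ γ : Module.Dual K W,
      (2 : K) • P (D.dualMap γ) =
        f (ψ.symm ((L : g →ₗ[K] W).dualMap γ + (R : g →ₗ[K] W).dualMap γ)))
    {α : Module.Dual K V} (hα : P α = 0) :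
    (L.symm : W →ₗ[K] g).dualMap (f.dualMap α) +
      (R.symm : W →ₗ[K] g).dualMap (f.dualMap α) = 0 := by
  obtain ⟨x, hx⟩ := ψ.surjective (f.dualMap α)
  rw [← hx]
  refine dualMap_symm_add_eq_zero_of_orthogonal L R (ψ : g →ₗ[K] Module.Dual K g) horth ?_
  refine (Module.forall_dual_apply_eq_zero_iff K _).1 fun γ => ?_
  set ν := (L : g →ₗ[K] W).dualMap γ + (R : g →ₗ[K] W).dualMap γ with hν
  have h : ν x = 0 := calc
    ν x = ψ x (ψ.symm ν) := by rw [hψsym, ψ.apply_symm_apply]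
    _ = α ((2 : K) • P (D.dualMap γ)) := by rw [hx, hPmom γ, LinearMap.dualMap_apply]
    _ = 0 := by rw [map_smul, hskew, hα, map_zero, neg_zero, smul_zero]
  simpa [hν] using h

/-- On the kernel of `L* + R*`, the composite `f* ∘ D*` equals `2 L*`. -/
theorem dualMap_dualMap_of_mem_ker (L R : g ≃ₗ[K] W) (D : V →ₗ[K] W) (f : g →ₗ[K] V)
    (hDf : ∀ ξ : g, D (f ξ) = L ξ - R ξ) {γ : Module.Dual K W}
    (hγ : (L : g →ₗ[K] W).dualMap γ + (R : g →ₗ[K] W).dualMap γ = 0) :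
    f.dualMap (D.dualMap γ) = (2 : K) • (L : g →ₗ[K] W).dualMap γ := by
  ext ξ
  have h : γ (L ξ) + γ (R ξ) = 0 := LinearMap.congr_fun hγ ξ
  simp only [LinearMap.dualMap_apply, hDf, map_sub, LinearMap.smul_apply, smul_eq_mul,
    LinearEquiv.coe_coe]
  linear_combination -h

/-- The composite `f* ∘ D*` maps the kernel of `L* + R*` onto the kernel of
`(L⁻¹)* + (R⁻¹)*`. -/
theorem exists_dualMap_dualMap_eq [CharZero K] (L R : g ≃ₗ[K] W) (D : V →ₗ[K] W) (f : g →ₗ[K] V)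
    (hDf : ∀ ξ : g, D (f ξ) = L ξ - R ξ) {μ : Module.Dual K g}
    (hμ : (L.symm : W →ₗ[K] g).dualMap μ + (R.symm : W →ₗ[K] g).dualMap μ = 0) :
    ∃ γ : Module.Dual K W, (L : g →ₗ[K] W).dualMap γ + (R : g →ₗ[K] W).dualMap γ = 0 ∧
      f.dualMap (D.dualMap γ) = μ := by
  have hγ : (L : g →ₗ[K] W).dualMap ((2 : K)⁻¹ • (L.symm : W →ₗ[K] g).dualMap μ) +
      (R : g →ₗ[K] W).dualMap ((2 : K)⁻¹ • (L.symm : W →ₗ[K] g).dualMap μ) = 0 := by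
    ext ξ
    have h : μ (L.symm (R ξ)) + μ (R.symm (R ξ)) = 0 := LinearMap.congr_fun hμ (R ξ)
    rw [R.symm_apply_apply] at h
    simp only [LinearMap.add_apply, LinearMap.dualMap_apply, LinearMap.smul_apply, smul_eq_mul,
      LinearEquiv.coe_coe, L.symm_apply_apply, LinearMap.zero_apply]
    linear_combination (2 : K)⁻¹ * h
  refine ⟨_, hγ, ?_⟩
  rw [dualMap_dualMap_of_mem_ker L R D f hDf hγ]
  ext ξ
  simp

end FiberwisePoisson


/-- fiberwise version of Proposition "nondegqhP": for a skew map `P♯`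
satisfying the P-momentum condition, six quasi non-degeneracy conditions are pairwise
equivalent. -/
theorem statement14 (K V W g : Type*) [Field K] [CharZero K]
    [AddCommGroup V] [Module K V] [FiniteDimensional K V]
    [AddCommGroup W] [Module K W] [FiniteDimensional K W]
    [AddCommGroup g] [Module K g] [FiniteDimensional K g]
    (L R : g ≃ₗ[K] W) (D : V →ₗ[K] W) (fund : g →ₗ[K] V)
    (hDfund : ∀ ξ : g, D (fund ξ) = L ξ - R ξ)
    (ψ : g ≃ₗ[K] Module.Dual K g)
    (hψsym : ∀ x y : g, ψ x y = ψ y x)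
    (horth : ∀ ξ η : g, ψ (L.symm (R ξ)) (L.symm (R η)) = ψ ξ η)
    (P : Module.Dual K V →ₗ[K] V)
    (hskew : ∀ α β : Module.Dual K V, α (P β) = - β (P α))
    (hPmom : ∀ γ : Module.Dual K W,
      (2 : K) • P (D.dualMap γ) =
        fund (ψ.symm ((L : g →ₗ[K] W).dualMap γ + (R : g →ₗ[K] W).dualMap γ))) :
    [(⇑D.dualMap ''
        {γ : Module.Dual K W |
          (L : g →ₗ[K] W).dualMap γ + (R : g →ₗ[K] W).dualMap γ = 0} =
      {α : Module.Dual K V | P α = 0}),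
     (Set.InjOn ⇑D.dualMap
        {γ : Module.Dual K W |
          (L : g →ₗ[K] W).dualMap γ + (R : g →ₗ[K] W).dualMap γ = 0} ∧
      ⇑D.dualMap ''
          {γ : Module.Dual K W |
            (L : g →ₗ[K] W).dualMap γ + (R : g →ₗ[K] W).dualMap γ = 0} =
        {α : Module.Dual K V | P α = 0}),
     (∀ α : Module.Dual K V, P α = 0 → fund.dualMap α = 0 → α = 0),
     Function.Surjective (fun z : Module.Dual K V × g => P z.1 + fund z.2),
     (Set.InjOn ⇑fund.dualMap {α : Module.Dual K V | P α = 0} ∧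
      ⇑fund.dualMap '' {α : Module.Dual K V | P α = 0} ⊆
        {μ : Module.Dual K g |
          (L.symm : W →ₗ[K] g).dualMap μ + (R.symm : W →ₗ[K] g).dualMap μ = 0}),
     (Set.InjOn ⇑fund.dualMap {α : Module.Dual K V | P α = 0} ∧
      ⇑fund.dualMap '' {α : Module.Dual K V | P α = 0} =
        {μ : Module.Dual K g |
          (L.symm : W →ₗ[K] g).dualMap μ + (R.symm : W →ₗ[K] g).dualMap μ = 0})].TFAE := by
  have hDker : ∀ γ : Module.Dual K W,
      (L : g →ₗ[K] W).dualMap γ + (R : g →ₗ[K] W).dualMap γ = 0 → P (D.dualMap γ) = 0 := by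
    intro γ hγ
    have h := hPmom γ
    rw [hγ, map_zero, map_zero] at h
    exact (smul_eq_zero.1 h).resolve_left two_ne_zero
  have hfund_ker : ∀ α : Module.Dual K V, P α = 0 →
      (L.symm : W →ₗ[K] g).dualMap (fund.dualMap α) +
        (R.symm : W →ₗ[K] g).dualMap (fund.dualMap α) = 0 := fun α hα =>
    dualMap_symm_add_eq_zero_of_momentum L R D fund ψ hψsym horth P hskew hPmom hα
  have hcomp := fun (γ : Module.Dual K W) hγ =>
    dualMap_dualMap_of_mem_ker L R D fund hDfund (γ := γ) hγ
  have hLinj : Function.Injective (L : g →ₗ[K] W).dualMap :=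
    LinearMap.dualMap_injective_of_surjective L.surjective
  tfae_have 1 → 2 := by
    refine fun h => ⟨fun γ hγ γ' hγ' heq => hLinj ?_, h⟩
    have h2 := congrArg fund.dualMap heq
    rw [hcomp γ hγ, hcomp γ' hγ'] at h2
    exact smul_right_injective _ (two_ne_zero : (2 : K) ≠ 0) h2
  tfae_have 2 → 3 := by
    rintro ⟨-, h⟩ α hP hf
    obtain ⟨γ, hγ, rfl⟩ := h.ge hP
    rw [hcomp γ hγ] at hf
    have hLγ := (smul_eq_zero.1 hf).resolve_left two_ne_zero
    rw [(map_eq_zero_iff _ hLinj).1 hLγ, map_zero]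
  tfae_have 3 ↔ 4 := (surjective_add_iff_of_skew fund P hskew).symm
  tfae_have 3 → 5 := by
    refine fun h => ⟨fun α hα β hβ heq => sub_eq_zero.1 (h _ ?_ ?_), ?_⟩
    · rw [map_sub, show P α = 0 from hα, show P β = 0 from hβ, sub_zero]
    · rw [map_sub, heq, sub_self]
    · rintro _ ⟨α, hα, rfl⟩
      exact hfund_ker α hα
  tfae_have 5 → 6 := by
    rintro ⟨hinj, hsub⟩
    refine ⟨hinj, hsub.antisymm fun μ hμ => ?_⟩
    obtain ⟨γ, hγ, rfl⟩ := exists_dualMap_dualMap_eq L R D fund hDfund hμ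
    exact ⟨_, hDker γ hγ, rfl⟩
  tfae_have 6 → 1 := by
    rintro ⟨hinj, -⟩
    refine Set.Subset.antisymm ?_ fun α hα => ?_
    · rintro _ ⟨γ, hγ, rfl⟩
      exact hDker γ hγ
    · obtain ⟨γ, hγ, heq⟩ := exists_dualMap_dualMap_eq L R D fund hDfund (hfund_ker α hα)
      exact ⟨γ, hγ, hinj (hDker γ hγ) hα heq⟩
  tfae_finish
end

section
/- Let σ be an alternating bilinear form on V that satisfies the σ-momentum condition and is Φ-non-degenerate. Then there exists a unique skew linear map P♯ : V* → V satisfying the P-momentum condition together with the duality relation P♯ ∘ σ♭ = Id_V − (1/4)ρ; moreover, this P♯ is quasi non-degenerate (the map (α, ξ) ↦ P♯(α) + fund(ξ) from V* ⊕ g to V is surjective) and also satisfies σ♭ ∘ P♯ = Id_{V*} − (1/4)ρ*, where ρ* : V* → V* is the dual of ρ. -/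
section MomentumDuality

variable {K V g : Type*} [Field K] [AddCommGroup V] [Module K V] [AddCommGroup g] [Module K g]

/-- A linear map which vanishes on the kernel of a surjective linear map factors through it. -/
theorem LinearMap.exists_comp_apply_eq_of_ker_le {E F G : Type*} [AddCommGroup E] [Module K E]
    [AddCommGroup F] [Module K F] [AddCommGroup G] [Module K G] (f : E →ₗ[K] F) (u : E →ₗ[K] G)
    (hf : Function.Surjective f) (h : ∀ z, f z = 0 → u z = 0) :
    ∃ P : F →ₗ[K] G, ∀ z, P (f z) = u z := by
  obtain ⟨s, hs⟩ := f.exists_rightInverse_of_surjective (LinearMap.range_eq_top.2 hf)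
  refine ⟨u ∘ₗ s, fun z => ?_⟩
  have hfs : f (s (f z)) = f z := LinearMap.congr_fun hs (f z)
  have := h (s (f z) - z) (by rw [map_sub, hfs, sub_self])
  rwa [map_sub, sub_eq_zero] at this

/-- The map `V × g → V*`, `(X, ξ) ↦ σ♭(X) + B(ξ, θ ·)`. -/
def covectorMap (σ : V →ₗ[K] Module.Dual K V) (ψ : g →ₗ[K] Module.Dual K g) (θ : V →ₗ[K] g) :
    V × g →ₗ[K] Module.Dual K V :=
  σ.coprod (θ.dualMap ∘ₗ ψ)

theorem covectorMap_apply (σ : V →ₗ[K] Module.Dual K V) (ψ : g →ₗ[K] Module.Dual K g)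
    (θ : V →ₗ[K] g) (z : V × g) (Y : V) :
    covectorMap σ ψ θ z Y = σ z.1 Y + ψ z.2 (θ Y) := by
  simp [covectorMap]

/-- The map `V × g → V`, `(X, ξ) ↦ X - ¼ fund (1 - A⁻¹) θ X + ½ fund (1 + A⁻¹) ξ`. -/
def vectorMap (A : g ≃ₗ[K] g) (fund : g →ₗ[K] V) (θ : V →ₗ[K] g) : V × g →ₗ[K] V :=
  (LinearMap.id - (4 : K)⁻¹ • (fund ∘ₗ (LinearMap.id - (A.symm : g →ₗ[K] g)) ∘ₗ θ)).coprod
    ((2 : K)⁻¹ • (fund ∘ₗ (LinearMap.id + (A.symm : g →ₗ[K] g))))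

theorem vectorMap_apply (A : g ≃ₗ[K] g) (fund : g →ₗ[K] V) (θ : V →ₗ[K] g) (z : V × g) :
    vectorMap A fund θ z = z.1 - (4 : K)⁻¹ • fund (θ z.1 - A.symm (θ z.1)) +
      (2 : K)⁻¹ • fund (z.2 + A.symm z.2) := by
  simp [vectorMap]

theorem covectorMap_surjective [FiniteDimensional K V] (σ : V →ₗ[K] Module.Dual K V)
    (halt : ∀ v, σ v v = 0) (ψ : g →ₗ[K] Module.Dual K g) (hψ : Function.Injective ψ)
    (hψsym : ∀ x y, ψ x y = ψ y x) (θ : V →ₗ[K] g)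
    (hnd : ∀ X, σ X = 0 → θ X = 0 → X = 0) :
    Function.Surjective (covectorMap σ ψ θ) := by
  rw [← LinearMap.dualMap_injective_iff, injective_iff_map_eq_zero]
  intro f hf
  obtain ⟨Y, rfl⟩ := (Module.evalEquiv K V).surjective f
  have hY : ∀ z, covectorMap σ ψ θ z Y = 0 := fun z => by
    simpa using LinearMap.congr_fun hf z
  suffices Y = 0 by rw [this, map_zero]
  have hskew : ∀ X Y, - σ X Y = σ Y X := LinearMap.IsAlt.neg halt
  refine hnd Y (LinearMap.ext fun X => ?_) ((map_eq_zero_iff ψ hψ).1 (LinearMap.ext fun ξ => ?_))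
  · have := hY (X, 0)
    rw [covectorMap_apply] at this
    simpa [← hskew X Y] using this
  · have := hY (0, ξ)
    rw [covectorMap_apply] at this
    simpa [hψsym ξ] using this

variable (A : g ≃ₗ[K] g) (fund : g →ₗ[K] V) (θ : V →ₗ[K] g) (ψ : g →ₗ[K] Module.Dual K g)
  (σ : V →ₗ[K] Module.Dual K V)

theorem vectorMap_eq_zero_of_covectorMap_eq_zero [CharZero K]
    (hθ : ∀ ξ, θ (fund ξ) = ξ - A ξ) (hψ : Function.Injective ψ)
    (hA : ∀ x y, ψ (A x) y = ψ x (A.symm y)) (hψsym : ∀ x y, ψ x y = ψ y x)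
    (halt : ∀ v, σ v v = 0)
    (hmom : ∀ ξ X, σ (fund ξ) X = (2 : K)⁻¹ * ψ ξ (θ X + A.symm (θ X)))
    (hnd : ∀ X, σ X = 0 → θ X = 0 → X = 0) (z : V × g) (hz : covectorMap σ ψ θ z = 0) :
    vectorMap A fund θ z = 0 := by
  obtain ⟨X, ξ⟩ := z
  have hskew : ∀ X Y, - σ X Y = σ Y X := LinearMap.IsAlt.neg halt
  have hz' : ∀ Y, σ X Y = - ψ ξ (θ Y) := fun Y => by
    have := LinearMap.congr_fun hz Y
    rw [covectorMap_apply] at this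
    exact eq_neg_of_add_eq_zero_left this
  have hA' : ∀ x y, ψ (A.symm x) y = ψ x (A y) := fun x y => by
    simpa using (hA (A.symm x) (A y)).symm
  have hrel : (2 : K)⁻¹ • (θ X + A.symm (θ X)) = ξ - A.symm ξ := by
    refine hψ (LinearMap.ext fun η => ?_)
    have h₁ := hz' (fund η)
    rw [← hskew, hmom, hθ, hψsym η] at h₁
    simp only [map_sub, map_smul, LinearMap.sub_apply, LinearMap.smul_apply, smul_eq_mul, hA'] at *
    linear_combination -h₁
  have hrel' : (2 : K)⁻¹ • (A (θ X) + θ X) = A ξ - ξ := by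
    simpa using congrArg A hrel
  rw [vectorMap_apply]
  refine hnd _ (LinearMap.ext fun Y => ?_) ?_
  · have h₁ := congrArg (fun x => ψ x (θ Y)) hrel
    have h₂ := congrArg (fun x => ψ x (θ Y)) hrel'
    simp only [map_add, map_sub, map_smul, LinearMap.add_apply, LinearMap.sub_apply,
      LinearMap.smul_apply, smul_eq_mul, hmom, hz', hA, hA', LinearEquiv.apply_symm_apply,
      LinearMap.zero_apply] at *
    linear_combination (4 : K)⁻¹ * h₁ - (4 : K)⁻¹ * h₂
  · simp only [map_add, map_sub, map_smul, hθ, LinearEquiv.apply_symm_apply] at *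
    linear_combination (norm := module) (2 : K)⁻¹ • hrel + (2 : K)⁻¹ • hrel'

theorem covectorMap_vectorMap_self [CharZero K]
    (hθ : ∀ ξ, θ (fund ξ) = ξ - A ξ)
    (hA : ∀ x y, ψ (A x) y = ψ x (A.symm y)) (hψsym : ∀ x y, ψ x y = ψ y x)
    (halt : ∀ v, σ v v = 0)
    (hmom : ∀ ξ X, σ (fund ξ) X = (2 : K)⁻¹ * ψ ξ (θ X + A.symm (θ X))) (z : V × g) :
    covectorMap σ ψ θ z (vectorMap A fund θ z) = 0 := by
  obtain ⟨X, ξ⟩ := z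
  have hskew : ∀ X Y, - σ X Y = σ Y X := LinearMap.IsAlt.neg halt
  have hA' : ∀ x y, ψ (A.symm x) y = ψ x (A y) := fun x y => by
    simpa using (hA (A.symm x) (A y)).symm
  have hself : ∀ x, ψ x (A x) = ψ x (A.symm x) := fun x => by rw [hψsym, hA]
  have hσ : ∀ η, σ X (fund η) = -((2 : K)⁻¹ * ψ η (θ X + A.symm (θ X))) := fun η => by
    rw [← hmom, hskew]
  rw [covectorMap_apply, vectorMap_apply]
  simp only [map_add, map_sub, map_smul, smul_eq_mul, hσ, halt, hθ, hA', hself,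
    LinearEquiv.apply_symm_apply]
  ring

end MomentumDuality

/-- fiberwise momentum duality, one direction of Theorem "existence":
given a Φ-non-degenerate alternating form `σ` satisfying the σ-momentum condition,
there is a unique skew map `P♯` satisfying the P-momentum condition and the duality
relation `P♯ ∘ σ♭ = Id − (1/4)ρ`; moreover this `P♯` is quasi non-degenerate and
satisfies `σ♭ ∘ P♯ = Id − (1/4)ρ*`. -/
theorem statement15 (K V W g : Type*) [Field K] [CharZero K]
    [AddCommGroup V] [Module K V] [FiniteDimensional K V]
    [AddCommGroup W] [Module K W] [FiniteDimensional K W]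
    [AddCommGroup g] [Module K g] [FiniteDimensional K g]
    (L R : g ≃ₗ[K] W) (D : V →ₗ[K] W) (fund : g →ₗ[K] V)
    (hDfund : ∀ ξ : g, D (fund ξ) = L ξ - R ξ)
    (ψ : g ≃ₗ[K] Module.Dual K g)
    (hψsym : ∀ x y : g, ψ x y = ψ y x)
    (horth : ∀ ξ η : g, ψ (L.symm (R ξ)) (L.symm (R η)) = ψ ξ η)
    (σ : V →ₗ[K] Module.Dual K V) (halt : ∀ v : V, σ v v = 0)
    (hmom : ∀ (ξ : g) (X : V),
      σ (fund ξ) X = (2 : K)⁻¹ * ψ ξ (L.symm (D X) + R.symm (D X)))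
    (hnd : Function.Injective fun X : V => (σ X, D X)) :
    ∃ P : Module.Dual K V →ₗ[K] V,
      ((∀ α β : Module.Dual K V, α (P β) = - β (P α)) ∧
       (∀ γ : Module.Dual K W,
          (2 : K) • P (D.dualMap γ) =
            fund (ψ.symm ((L : g →ₗ[K] W).dualMap γ + (R : g →ₗ[K] W).dualMap γ))) ∧
       P ∘ₗ σ = LinearMap.id -
          (4 : K)⁻¹ • (fund ∘ₗ ((L.symm : W →ₗ[K] g) - (R.symm : W →ₗ[K] g)) ∘ₗ D)) ∧
      (∀ P' : Module.Dual K V →ₗ[K] V,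
        ((∀ α β : Module.Dual K V, α (P' β) = - β (P' α)) ∧
         (∀ γ : Module.Dual K W,
            (2 : K) • P' (D.dualMap γ) =
              fund (ψ.symm ((L : g →ₗ[K] W).dualMap γ + (R : g →ₗ[K] W).dualMap γ))) ∧
         P' ∘ₗ σ = LinearMap.id -
            (4 : K)⁻¹ • (fund ∘ₗ ((L.symm : W →ₗ[K] g) - (R.symm : W →ₗ[K] g)) ∘ₗ D)) →
        P' = P) ∧
      Function.Surjective (fun z : Module.Dual K V × g => P z.1 + fund z.2) ∧
      σ ∘ₗ P = LinearMap.id -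
        (4 : K)⁻¹ •
          (fund ∘ₗ ((L.symm : W →ₗ[K] g) - (R.symm : W →ₗ[K] g)) ∘ₗ D).dualMap := by
  set A : g ≃ₗ[K] g := R.trans L.symm
  set θ : V →ₗ[K] g := (L.symm : W →ₗ[K] g) ∘ₗ D
  have hθ : ∀ ξ, θ (fund ξ) = ξ - A ξ := fun ξ => by simp [A, θ, hDfund]
  have hA : ∀ x y, ψ (A x) y = ψ x (A.symm y) := fun x y => by
    simpa [A] using horth x (A.symm y)
  have hA' : ∀ x y, ψ (A.symm x) y = ψ x (A y) := fun x y => by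
    simpa using (hA (A.symm x) (A y)).symm
  have hR : ∀ X, R.symm (D X) = A.symm (θ X) := fun X => by simp [A, θ]
  have hmom' : ∀ ξ X, σ (fund ξ) X =
      (2 : K)⁻¹ * (ψ : g →ₗ[K] Module.Dual K g) ξ (θ X + A.symm (θ X)) := fun ξ X => by
    rw [hmom, hR]; rfl
  have hnd' : ∀ X, σ X = 0 → θ X = 0 → X = 0 := fun X h₁ h₂ => by
    refine hnd (Prod.ext ?_ ?_)
    · simpa using h₁
    · simpa [θ] using h₂
  have hρ : ∀ X, (fund ∘ₗ ((L.symm : W →ₗ[K] g) - (R.symm : W →ₗ[K] g)) ∘ₗ D) X =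
      fund (θ X - A.symm (θ X)) := fun X => by simp [A, θ]
  have hsurj := covectorMap_surjective σ halt ψ.toLinearMap ψ.injective hψsym θ hnd'
  have hdual : ∀ γ : Module.Dual K W, D.dualMap γ =
      covectorMap σ ψ.toLinearMap θ (0, ψ.symm ((L : g →ₗ[K] W).dualMap γ)) := fun γ => by
    ext Y
    simp [covectorMap_apply, θ]
  have hRγ : ∀ γ : Module.Dual K W, ψ.symm ((R : g →ₗ[K] W).dualMap γ) =
      A.symm (ψ.symm ((L : g →ₗ[K] W).dualMap γ)) := fun γ => by
    rw [LinearEquiv.symm_apply_eq]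
    ext η
    rw [hA']
    simp [A]
  obtain ⟨P, hP⟩ := LinearMap.exists_comp_apply_eq_of_ker_le (covectorMap σ ψ.toLinearMap θ)
    (vectorMap A fund θ) hsurj
    (vectorMap_eq_zero_of_covectorMap_eq_zero A fund θ ψ.toLinearMap σ hθ ψ.injective hA hψsym
      halt hmom' hnd')
  have hskewP : ∀ α β : Module.Dual K V, α (P β) = - β (P α) := by
    have hself : ∀ α : Module.Dual K V, α (P α) = 0 := fun α => by
      obtain ⟨z, rfl⟩ := hsurj α
      rw [hP]
      exact covectorMap_vectorMap_self A fund θ ψ.toLinearMap σ hθ hA hψsym halt hmom' z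
    intro α β
    have := hself (α + β)
    simp only [map_add, LinearMap.add_apply, hself, zero_add, add_zero] at this
    exact eq_neg_of_add_eq_zero_right this
  have hPD : ∀ γ : Module.Dual K W, (2 : K) • P (D.dualMap γ) =
      fund (ψ.symm ((L : g →ₗ[K] W).dualMap γ + (R : g →ₗ[K] W).dualMap γ)) := fun γ => by
    rw [hdual, hP, vectorMap_apply, map_add ψ.symm, hRγ]
    simp
  have hPσ : ∀ X, P (σ X) = X - (4 : K)⁻¹ • fund (θ X - A.symm (θ X)) := fun X => by
    have := hP (X, 0)
    rw [vectorMap_apply] at this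
    simpa [covectorMap] using this
  have hPσ' : P ∘ₗ σ = LinearMap.id -
      (4 : K)⁻¹ • (fund ∘ₗ ((L.symm : W →ₗ[K] g) - (R.symm : W →ₗ[K] g)) ∘ₗ D) := by
    ext X
    rw [LinearMap.comp_apply, hPσ, LinearMap.sub_apply, LinearMap.smul_apply, hρ,
      LinearMap.id_apply]
  refine ⟨P, ⟨hskewP, hPD, hPσ'⟩, ?_, fun X => ?_, ?_⟩
  · rintro P' ⟨-, hPD', hP'σ⟩
    refine LinearMap.ext fun α => ?_
    obtain ⟨⟨X, ξ⟩, rfl⟩ := hsurj α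
    have hξ : covectorMap σ ψ.toLinearMap θ (X, ξ) =
        σ X + D.dualMap ((L.symm : W →ₗ[K] g).dualMap (ψ ξ)) := by
      ext Y
      simp [covectorMap_apply, θ]
    rw [hξ, map_add, map_add]
    congr 1
    · exact LinearMap.congr_fun (hP'σ.trans hPσ'.symm) X
    · exact smul_right_injective V (two_ne_zero (α := K)) ((hPD' _).trans (hPD _).symm)
  · refine ⟨(σ X, (4 : K)⁻¹ • (θ X - A.symm (θ X))), ?_⟩
    simp only [hPσ, map_smul, sub_add_cancel]
  · ext α X
    have hskew : ∀ X Y, - σ X Y = σ Y X := LinearMap.IsAlt.neg halt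
    calc σ (P α) X = α (P (σ X)) := by rw [hskewP α, hskew]
      _ = α ((P ∘ₗ σ) X) := rfl
      _ = _ := by rw [hPσ']; simp
end

section
/- Let P♯ : V* → V be a skew linear map that satisfies the P-momentum condition and is quasi non-degenerate. Then there exists a unique alternating bilinear form σ on V satisfying the σ-momentum condition together with the duality relation σ♭ ∘ P♯ = Id_{V*} − (1/4)ρ*, where ρ* : V* → V* is the dual of ρ; moreover, this σ is Φ-non-degenerate (the map X ↦ (σ♭(X), D(X)) from V to V* ⊕ W is injective) and also satisfies P♯ ∘ σ♭ = Id_V − (1/4)ρ. -/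
section MomentumDuality

variable {K V W g : Type*} [Field K] [AddCommGroup V] [Module K V]
  [AddCommGroup W] [Module K W] [AddCommGroup g] [Module K g]

/-- The P-momentum condition and skewness determine `D ∘ P`. -/
theorem two_smul_apply_of_momentum
    {L R : g ≃ₗ[K] W} {D : V →ₗ[K] W} {fund : g →ₗ[K] V} {ψ : g ≃ₗ[K] Module.Dual K g}
    {P : Module.Dual K V →ₗ[K] V}
    (hψsym : ∀ x y : g, ψ x y = ψ y x)
    (hskew : ∀ α β : Module.Dual K V, α (P β) = - β (P α))
    (hPmom : ∀ γ : Module.Dual K W,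
      (2 : K) • P (D.dualMap γ) =
        fund (ψ.symm ((L : g →ₗ[K] W).dualMap γ + (R : g →ₗ[K] W).dualMap γ)))
    (α : Module.Dual K V) :
    (2 : K) • D (P α) =
      -(L (ψ.symm (fund.dualMap α)) + R (ψ.symm (fund.dualMap α))) := by
  refine sub_eq_zero.mp <| (Module.forall_dual_apply_eq_zero_iff K _).mp fun γ => ?_
  have hψ : ∀ β : Module.Dual K g, α (fund (ψ.symm β)) = β (ψ.symm (fund.dualMap α)) := by
    intro β
    have h := hψsym (ψ.symm (fund.dualMap α)) (ψ.symm β)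
    simpa using h
  rw [map_sub, sub_eq_zero]
  have h := congrArg α (hPmom γ)
  rw [hψ, map_smul, hskew] at h
  simp only [LinearMap.dualMap_apply, LinearMap.add_apply, smul_eq_mul,
    LinearEquiv.coe_coe] at h
  simp only [map_smul, map_neg, map_add, smul_eq_mul]
  linear_combination -h

/-- The map `V* × g → V*` through which the form `σ` is determined along
`(α, ξ) ↦ P α + fund ξ`. -/
noncomputable def momentumPairing (L R : g ≃ₗ[K] W) (D : V →ₗ[K] W) (fund : g →ₗ[K] V)
    (ψ : g ≃ₗ[K] Module.Dual K g) : Module.Dual K V × g →ₗ[K] Module.Dual K V :=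
  (LinearMap.id - (4 : K)⁻¹ •
    (fund ∘ₗ ((L.symm : W →ₗ[K] g) - (R.symm : W →ₗ[K] g)) ∘ₗ D).dualMap).coprod
  ((2 : K)⁻¹ •
    (((L.symm : W →ₗ[K] g) + (R.symm : W →ₗ[K] g)) ∘ₗ D).dualMap ∘ₗ (ψ : g →ₗ[K] _))

theorem momentumPairing_apply (L R : g ≃ₗ[K] W) (D : V →ₗ[K] W) (fund : g →ₗ[K] V)
    (ψ : g ≃ₗ[K] Module.Dual K g) (α : Module.Dual K V) (ξ : g) (X : V) :
    momentumPairing L R D fund ψ (α, ξ) X =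
      α X - (4 : K)⁻¹ * α (fund (L.symm (D X) - R.symm (D X))) +
        (2 : K)⁻¹ * ψ ξ (L.symm (D X) + R.symm (D X)) := by
  simp [momentumPairing, LinearMap.dualMap_apply]

/-- The pairing is alternating after precomposition with `(α, ξ) ↦ P α + fund ξ`. -/
theorem momentumPairing_self [CharZero K]
    {L R : g ≃ₗ[K] W} {D : V →ₗ[K] W} {fund : g →ₗ[K] V} {ψ : g ≃ₗ[K] Module.Dual K g}
    {P : Module.Dual K V →ₗ[K] V}
    (hDfund : ∀ ξ : g, D (fund ξ) = L ξ - R ξ)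
    (hψsym : ∀ x y : g, ψ x y = ψ y x)
    (horth : ∀ ξ η : g, ψ (L.symm (R ξ)) (L.symm (R η)) = ψ ξ η)
    (hskew : ∀ α β : Module.Dual K V, α (P β) = - β (P α))
    (hPmom : ∀ γ : Module.Dual K W,
      (2 : K) • P (D.dualMap γ) =
        fund (ψ.symm ((L : g →ₗ[K] W).dualMap γ + (R : g →ₗ[K] W).dualMap γ)))
    (z : Module.Dual K V × g) :
    momentumPairing L R D fund ψ z (P.coprod fund z) = 0 := by
  obtain ⟨α, ξ⟩ := z
  obtain ⟨a, ha⟩ : ∃ a, a = ψ.symm (fund.dualMap α) := ⟨_, rfl⟩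
  have hα : ∀ η, α (fund η) = ψ a η := fun η => by simp [ha]
  have hDP : D (P α) = (2 : K)⁻¹ • -(L a + R a) := by
    rw [ha, ← two_smul_apply_of_momentum hψsym hskew hPmom, inv_smul_smul₀ two_ne_zero]
  have hadj : ∀ x y, ψ x (L.symm (R y)) = ψ y (R.symm (L x)) := fun x y => by
    rw [hψsym y, ← horth _ y]
    simp
  have hPα : α (P α) = 0 := self_eq_neg.mp (hskew α α)
  rw [momentumPairing_apply]
  simp only [LinearMap.coprod_apply, map_add, map_sub, map_smul, map_neg, smul_eq_mul,
    hDfund, hDP, hα, hPα, LinearEquiv.symm_apply_apply, hadj]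
  rw [hψsym ξ a]
  field_simp
  ring

/-- A linear map alternating along a surjection descends to an alternating form. -/
theorem exists_alternating_comp_eq {U : Type*} [AddCommGroup U] [Module K U]
    (T : U →ₗ[K] V) (hT : Function.Surjective T) (S : U →ₗ[K] Module.Dual K V)
    (hS : ∀ z, S z (T z) = 0) :
    ∃ σ : V →ₗ[K] Module.Dual K V, (∀ v, σ v v = 0) ∧ σ ∘ₗ T = S := by
  have hker : ∀ z, T z = 0 → S z = 0 := by
    intro z hz
    ext X
    obtain ⟨w, rfl⟩ := hT X
    have h := hS (z + w)
    simpa [hz, hS] using h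
  obtain ⟨r, hr⟩ := T.exists_rightInverse_of_surjective (LinearMap.range_eq_top.mpr hT)
  have hσ : (S ∘ₗ r) ∘ₗ T = S := by
    ext1 z
    refine sub_eq_zero.mp ?_
    have h := hker (r (T z) - z) (by
      rw [map_sub, sub_eq_zero]
      exact LinearMap.congr_fun hr (T z))
    simpa using h
  refine ⟨S ∘ₗ r, fun v => ?_, hσ⟩
  obtain ⟨z, rfl⟩ := hT v
  exact (LinearMap.congr_fun (LinearMap.congr_fun hσ z) (T z)).trans (hS z)

end MomentumDuality


/-- fiberwise momentum duality, the other direction of Theorem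
"existence": given a quasi non-degenerate skew map `P♯` satisfying the P-momentum
condition, there is a unique alternating form `σ` satisfying the σ-momentum condition
and the duality relation `σ♭ ∘ P♯ = Id − (1/4)ρ*`; moreover this `σ` is
Φ-non-degenerate and satisfies `P♯ ∘ σ♭ = Id − (1/4)ρ`. -/
theorem statement16 (K V W g : Type*) [Field K] [CharZero K]
    [AddCommGroup V] [Module K V] [FiniteDimensional K V]
    [AddCommGroup W] [Module K W] [FiniteDimensional K W]
    [AddCommGroup g] [Module K g] [FiniteDimensional K g]
    (L R : g ≃ₗ[K] W) (D : V →ₗ[K] W) (fund : g →ₗ[K] V)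
    (hDfund : ∀ ξ : g, D (fund ξ) = L ξ - R ξ)
    (ψ : g ≃ₗ[K] Module.Dual K g)
    (hψsym : ∀ x y : g, ψ x y = ψ y x)
    (horth : ∀ ξ η : g, ψ (L.symm (R ξ)) (L.symm (R η)) = ψ ξ η)
    (P : Module.Dual K V →ₗ[K] V)
    (hskew : ∀ α β : Module.Dual K V, α (P β) = - β (P α))
    (hPmom : ∀ γ : Module.Dual K W,
      (2 : K) • P (D.dualMap γ) =
        fund (ψ.symm ((L : g →ₗ[K] W).dualMap γ + (R : g →ₗ[K] W).dualMap γ)))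
    (hqnd : Function.Surjective fun z : Module.Dual K V × g => P z.1 + fund z.2) :
    ∃ σ : V →ₗ[K] Module.Dual K V,
      ((∀ v : V, σ v v = 0) ∧
       (∀ (ξ : g) (X : V),
          σ (fund ξ) X = (2 : K)⁻¹ * ψ ξ (L.symm (D X) + R.symm (D X))) ∧
       σ ∘ₗ P = LinearMap.id -
          (4 : K)⁻¹ •
            (fund ∘ₗ ((L.symm : W →ₗ[K] g) - (R.symm : W →ₗ[K] g)) ∘ₗ D).dualMap) ∧
      (∀ σ' : V →ₗ[K] Module.Dual K V,
        ((∀ v : V, σ' v v = 0) ∧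
         (∀ (ξ : g) (X : V),
            σ' (fund ξ) X = (2 : K)⁻¹ * ψ ξ (L.symm (D X) + R.symm (D X))) ∧
         σ' ∘ₗ P = LinearMap.id -
            (4 : K)⁻¹ •
              (fund ∘ₗ ((L.symm : W →ₗ[K] g) - (R.symm : W →ₗ[K] g)) ∘ₗ D).dualMap) →
        σ' = σ) ∧
      Function.Injective (fun X : V => (σ X, D X)) ∧
      P ∘ₗ σ = LinearMap.id -
        (4 : K)⁻¹ • (fund ∘ₗ ((L.symm : W →ₗ[K] g) - (R.symm : W →ₗ[K] g)) ∘ₗ D) := by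
  have hT : Function.Surjective (P.coprod fund) := fun v => by simpa using hqnd v
  obtain ⟨σ, halt, hσ⟩ := exists_alternating_comp_eq (P.coprod fund) hT
    (momentumPairing L R D fund ψ) (momentumPairing_self hDfund hψsym horth hskew hPmom)
  have hmom : ∀ (ξ : g) (X : V),
      σ (fund ξ) X = (2 : K)⁻¹ * ψ ξ (L.symm (D X) + R.symm (D X)) := by
    intro ξ X
    have h := LinearMap.congr_fun (LinearMap.congr_fun hσ (0, ξ)) X
    rw [momentumPairing_apply] at h
    simpa using h
  have hσP : σ ∘ₗ P = LinearMap.id - (4 : K)⁻¹ •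
      (fund ∘ₗ ((L.symm : W →ₗ[K] g) - (R.symm : W →ₗ[K] g)) ∘ₗ D).dualMap := by
    rw [momentumPairing] at hσ
    simpa [LinearMap.comp_assoc] using congrArg (· ∘ₗ LinearMap.inl K _ _) hσ
  have hPσ : P ∘ₗ σ = LinearMap.id -
      (4 : K)⁻¹ • (fund ∘ₗ ((L.symm : W →ₗ[K] g) - (R.symm : W →ₗ[K] g)) ∘ₗ D) := by
    ext X
    refine sub_eq_zero.mp <| (Module.forall_dual_apply_eq_zero_iff K _).mp fun α => ?_
    rw [map_sub, sub_eq_zero]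
    have hneg : σ (P α) X = - σ X (P α) := (LinearMap.IsAlt.neg halt X (P α)).symm
    have h := LinearMap.congr_fun (LinearMap.congr_fun hσP α) X
    rw [LinearMap.comp_apply, hneg, ← hskew] at h
    rw [LinearMap.comp_apply, h]
    simp [LinearMap.dualMap_apply]
  refine ⟨σ, ⟨halt, hmom, hσP⟩, ?_, ?_, hPσ⟩
  · rintro σ' ⟨-, hmom', hσP'⟩
    refine LinearMap.ext fun v => ?_
    obtain ⟨⟨α, ξ⟩, rfl⟩ := hT v
    have hα : σ' (P α) = σ (P α) := LinearMap.congr_fun (hσP'.trans hσP.symm) α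
    have hξ : σ' (fund ξ) = σ (fund ξ) := by
      ext X
      rw [hmom, hmom']
    simp only [LinearMap.coprod_apply, map_add, hα, hξ]
  · intro X Y h
    obtain ⟨hXY, hD⟩ := Prod.mk.inj h
    have hX := LinearMap.congr_fun hPσ X
    have hY := LinearMap.congr_fun hPσ Y
    simp only [LinearMap.comp_apply, LinearMap.sub_apply, LinearMap.smul_apply,
      LinearMap.id_apply, hXY, hD] at hX hY
    exact sub_left_injective (hX.symm.trans hY)
end
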